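/- arXiv:math/0702676 — 7 statements merged into one kernel-verified Lean document; each statement's English description precedes it below -/
import Mathlib

section
/- Assume: a, b, c are meromorphic on ℂ; c is analytic at every point of 2γℤ; a and b are analytic at every nonzero point of 2γℤ and have at most simple poles at 0; the residue of a + b at 0 vanishes, i.e. lim_{z→0} z·(a(z) + b(z)) = 0; a(2γm) = 0; and a(2jγ) = b(−2jγ) and c(2jγ) = c(−2jγ) for all j = ±1, …, ±m. Then D(Q_m) ⊆ Q_m: for every f ∈ Q_m the function Df extends analytically to every point of 2γℤ, and its extension g satisfies g(2jγ) = g(−2jγ) for j = 1, …, m. -/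
open Filter Topology

/-- A meromorphic function with `(z - x) * h z → 0` at `x` has a removable singularity there. -/
theorem MeromorphicAt.analyticAt_update_limUnder {h : ℂ → ℂ} {x : ℂ} (hh : MeromorphicAt h x)
    (hlim : Tendsto (fun z => (z - x) * h z) (𝓝[≠] x) (𝓝 0)) :
    AnalyticAt ℂ (Function.update h x (limUnder (𝓝[≠] x) h)) x := by
  have hev := hh.eventually_analyticAt
  rw [eventually_nhdsWithin_iff] at hev
  have hd : DifferentiableOn ℂ h ({z | z ∈ ({x}ᶜ : Set ℂ) → AnalyticAt ℂ h z} \ {x}) :=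
    fun z hz => (hz.1 hz.2).differentiableAt.differentiableWithinAt
  have ho : (fun z => h z - h x) =o[𝓝[≠] x] fun z => (z - x)⁻¹ := by
    refine Asymptotics.isLittleO_of_tendsto' ?_ ?_
    · filter_upwards [self_mem_nhdsWithin] with z hz h0
      exact absurd (sub_eq_zero.1 (inv_eq_zero.1 h0)) hz
    · have h1 : Tendsto (fun z : ℂ => (z - x) * h x) (𝓝[≠] x) (𝓝 0) := by
        have : Continuous fun z : ℂ => (z - x) * h x := by fun_prop
        simpa using (this.tendsto x).mono_left nhdsWithin_le_nhds
      have h2 := hlim.sub h1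
      rw [sub_zero] at h2
      refine h2.congr fun z => ?_
      rw [div_inv_eq_mul]
      ring
  exact (Complex.differentiableOn_update_limUnder_of_isLittleO hev hd ho).analyticAt hev

/-- **Lemma 2.2 (Chalykh).** Let `D f z = a z * f (z + 2γ) + b z * f (z - 2γ) + c z * f z`
be a three-term difference operator with meromorphic coefficients `a`, `b`, `c`, where
`c` is analytic on `2γℤ`, `a` and `b` are analytic at nonzero points of `2γℤ` with at most
simple poles at `0`, the residue of `a + b` at `0` vanishes, `a (2γm) = 0`, and
`a (2jγ) = b (-2jγ)`, `c (2jγ) = c (-2jγ)` for `j = ±1, …, ±m`.  Then `D` preserves the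
space `Q_m` of meromorphic functions that are analytic at points of `2γℤ` and satisfy
`f (2jγ) = f (-2jγ)` for `j = 1, …, m`. -/
theorem ruijsenaars_BC1_lemma_Qm_invariance
    (γ : ℂ) (hγ : γ ≠ 0) (m : ℕ) (hm : 1 ≤ m)
    (a b c : ℂ → ℂ)
    (haM : ∀ z : ℂ, MeromorphicAt a z)
    (hbM : ∀ z : ℂ, MeromorphicAt b z)
    (hcM : ∀ z : ℂ, MeromorphicAt c z)
    (hcA : ∀ n : ℤ, AnalyticAt ℂ c (2 * γ * n))
    (haA : ∀ n : ℤ, n ≠ 0 → AnalyticAt ℂ a (2 * γ * n))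
    (hbA : ∀ n : ℤ, n ≠ 0 → AnalyticAt ℂ b (2 * γ * n))
    (haPole : ∃ A : ℂ, Tendsto (fun z : ℂ => z * a z) (𝓝[≠] 0) (𝓝 A))
    (hbPole : ∃ B : ℂ, Tendsto (fun z : ℂ => z * b z) (𝓝[≠] 0) (𝓝 B))
    (hres : Tendsto (fun z : ℂ => z * (a z + b z)) (𝓝[≠] (0 : ℂ)) (𝓝 0))
    (ham : a (2 * γ * (m : ℂ)) = 0)
    (hab : ∀ j : ℤ, j ≠ 0 → |j| ≤ (m : ℤ) →
      a (2 * (j : ℂ) * γ) = b (-(2 * (j : ℂ) * γ)))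
    (hcc : ∀ j : ℤ, j ≠ 0 → |j| ≤ (m : ℤ) →
      c (2 * (j : ℂ) * γ) = c (-(2 * (j : ℂ) * γ))) :
    ∀ f : ℂ → ℂ,
      (∀ z : ℂ, MeromorphicAt f z) →
      (∀ n : ℤ, AnalyticAt ℂ f (2 * γ * n)) →
      (∀ j : ℕ, 1 ≤ j → j ≤ m → f (2 * (j : ℂ) * γ) = f (-(2 * (j : ℂ) * γ))) →
      ∃ g : ℂ → ℂ,
        (∀ z : ℂ, (¬∃ n : ℤ, z = 2 * γ * n) →
          g z = a z * f (z + 2 * γ) + b z * f (z - 2 * γ) + c z * f z) ∧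
        (∀ z : ℂ, MeromorphicAt g z) ∧
        (∀ n : ℤ, AnalyticAt ℂ g (2 * γ * n)) ∧
        (∀ j : ℕ, 1 ≤ j → j ≤ m → g (2 * (j : ℂ) * γ) = g (-(2 * (j : ℂ) * γ))) := by
  intro f hfM hfA hfs
  obtain ⟨B, hB⟩ := hbPole
  set h : ℂ → ℂ := fun z => a z * f (z + 2 * γ) + b z * f (z - 2 * γ) + c z * f z with hdef
  have hγ2 : (2 * γ : ℂ) ≠ 0 := mul_ne_zero two_ne_zero hγ
  have hshift (w z : ℂ) : MeromorphicAt (fun z => f (z + w)) z :=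
    (hfM (z + w)).comp_analyticAt (f := f) (g := fun z => z + w) (by fun_prop)
  have hhM (z : ℂ) : MeromorphicAt h z := by
    have h1 := hshift (2 * γ) z
    have h2 := hshift (-(2 * γ)) z
    simp only [← sub_eq_add_neg] at h2
    exact (((haM z).mul h1).add ((hbM z).mul h2)).add ((hcM z).mul (hfM z))
  have hf0 : AnalyticAt ℂ f 0 := by simpa using hfA 0
  have hfp : ContinuousAt f (2 * γ) := by simpa using (hfA 1).continuousAt
  have hfn : ContinuousAt f (-(2 * γ)) := by simpa using (hfA (-1)).continuousAt
  have hc0 : AnalyticAt ℂ c 0 := by simpa using hcA 0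
  have hlim : Tendsto (fun z => (z - 0) * h z) (𝓝[≠] 0) (𝓝 0) := by
    have hp : Tendsto (fun z => f (z + 2 * γ)) (𝓝[≠] 0) (𝓝 (f (2 * γ))) := by
      refine hfp.tendsto.comp (Tendsto.mono_left ?_ nhdsWithin_le_nhds)
      exact (continuous_id.add continuous_const).tendsto' 0 _ (by simp)
    have hn : Tendsto (fun z => f (z - 2 * γ)) (𝓝[≠] 0) (𝓝 (f (-(2 * γ)))) := by
      refine hfn.tendsto.comp (Tendsto.mono_left ?_ nhdsWithin_le_nhds)
      exact (continuous_id.sub continuous_const).tendsto' 0 _ (by simp)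
    have hcf : Tendsto (fun z => z * (c z * f z)) (𝓝[≠] 0) (𝓝 (0 * (c 0 * f 0))) :=
      (continuousAt_id.mul (hc0.continuousAt.mul hf0.continuousAt)).tendsto.mono_left
        nhdsWithin_le_nhds
    have hsymm : f (2 * γ) = f (-(2 * γ)) := by simpa using hfs 1 le_rfl hm
    have key := ((hres.mul hp).add (hB.mul (hn.sub hp))).add hcf
    rw [hsymm, sub_self, mul_zero, zero_mul, zero_mul, add_zero, add_zero] at key
    refine key.congr fun z => ?_
    simp only [hdef]
    ring
  refine ⟨Function.update h 0 (limUnder (𝓝[≠] 0) h), ?_, ?_, ?_, ?_⟩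
  · intro z hz
    have hz0 : z ≠ 0 := fun h0 => hz ⟨0, by simp [h0]⟩
    rw [Function.update_of_ne hz0]
  · exact fun z => (hhM z).update _ _
  · intro n
    rcases eq_or_ne n 0 with rfl | hn
    · simpa using (hhM 0).analyticAt_update_limUnder hlim
    · have hn0 : 2 * γ * (n : ℂ) ≠ 0 := mul_ne_zero hγ2 (Int.cast_ne_zero.2 hn)
      have h1 : AnalyticAt ℂ (fun z => f (z + 2 * γ)) (2 * γ * n) := by
        refine AnalyticAt.fun_comp (g := f) ?_ (by fun_prop)
        convert hfA (n + 1) using 1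
        push_cast
        ring
      have h2 : AnalyticAt ℂ (fun z => f (z - 2 * γ)) (2 * γ * n) := by
        refine AnalyticAt.fun_comp (g := f) ?_ (by fun_prop)
        convert hfA (n - 1) using 1
        push_cast
        ring
      have hhA : AnalyticAt ℂ h (2 * γ * n) :=
        (((haA n hn).mul h1).add ((hbA n hn).mul h2)).add ((hcA n).mul (hfA n))
      refine hhA.congr ?_
      filter_upwards [isOpen_ne.mem_nhds hn0] with z hz
      rw [Function.update_of_ne hz]
  · intro j hj hjm
    have hj0 : (j : ℂ) ≠ 0 := Nat.cast_ne_zero.2 (by omega)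
    have hz : 2 * (j : ℂ) * γ ≠ 0 := mul_ne_zero (mul_ne_zero two_ne_zero hj0) hγ
    rw [Function.update_of_ne hz, Function.update_of_ne (neg_ne_zero.2 hz)]
    have ha := hab j (by omega) (by rw [Nat.abs_cast]; omega)
    have hb := hab (-j) (by omega) (by rw [abs_neg, Nat.abs_cast]; omega)
    have hc := hcc j (by omega) (by rw [Nat.abs_cast]; omega)
    push_cast at ha hb hc
    rw [show -(2 * -(j : ℂ) * γ) = 2 * j * γ by ring,
      show 2 * -(j : ℂ) * γ = -(2 * j * γ) by ring] at hb
    have hfj := hfs j hj hjm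
    have hlow : f (2 * (j : ℂ) * γ - 2 * γ) = f (-(2 * (j : ℂ) * γ) + 2 * γ) := by
      obtain ⟨k, rfl⟩ := Nat.exists_eq_add_of_le' hj
      rcases Nat.eq_zero_or_pos k with rfl | hk
      · simp
      · have := hfs k hk (by omega)
        convert this using 2 <;> push_cast <;> ring
    have hhigh : b (-(2 * (j : ℂ) * γ)) * f (2 * (j : ℂ) * γ + 2 * γ) =
        b (-(2 * (j : ℂ) * γ)) * f (-(2 * (j : ℂ) * γ) - 2 * γ) := by
      rcases hjm.eq_or_lt with rfl | hlt
      · rw [← ha, show 2 * (j : ℂ) * γ = 2 * γ * j by ring, ham, zero_mul, zero_mul]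
      · have := hfs (j + 1) (by omega) hlt
        congr 1
        convert this using 2 <;> push_cast <;> ring
    simp only [hdef]
    rw [ha, ← hb, ← hc, ← hfj, hlow, hhigh]
    ring
end

section
/- Assume: a and c are meromorphic on ℂ; c is analytic at every point of 2γℤ; a is analytic at every nonzero point of 2γℤ and has at most a simple pole at 0; b(z) = a(−z) and c(−z) = c(z) for all z (so the operator D is invariant under z ↦ −z); and a(2γm) = 0. Then D(Q_m) ⊆ Q_m: for every f ∈ Q_m the function Df extends analytically to every point of 2γℤ, and its extension g satisfies g(2jγ) = g(−2jγ) for j = 1, …, m. -/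
open Filter Topology

/-- A meromorphic function with at most a simple pole at `0` agrees away from `0` with `p z / z`
for some `p` analytic at `0`. -/
theorem MeromorphicAt.exists_analyticAt_eq_div {a : ℂ → ℂ} {A : ℂ}
    (ha : MeromorphicAt a 0) (hA : Tendsto (fun z : ℂ => z * a z) (𝓝[≠] 0) (𝓝 A)) :
    ∃ p : ℂ → ℂ, AnalyticAt ℂ p 0 ∧ ∀ z, z ≠ 0 → a z = p z / z := by
  refine ⟨Function.update (fun z => z * a z) 0 A, ?_, fun z hz => ?_⟩
  · refine MeromorphicAt.analyticAt ?_ (continuousAt_update_same.mpr hA)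
    have hza : MeromorphicAt (fun z => z * a z) 0 := (MeromorphicAt.id 0).fun_mul ha
    refine hza.congr (eventually_mem_nhdsWithin.mono fun z hz => ?_)
    rw [Function.update_of_ne hz]
  · rw [Function.update_of_ne hz]
    field_simp

/-- The difference quotient of an analytic function, based at `x`, is analytic at `x`. -/
theorem AnalyticAt.analyticAt_dslope {N : ℂ → ℂ} {x : ℂ} (hN : AnalyticAt ℂ N x) :
    AnalyticAt ℂ (dslope N x) x := by
  obtain ⟨p, hp⟩ := hN
  exact hp.has_fpower_series_dslope_fslope.analyticAt

/-- If `a` has at most a simple pole at `0` and the analytic functions `u`, `v` agree at `0`, then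
the singularity of `a z * u z + a (-z) * v z` at `0` is removable. -/
theorem exists_analyticAt_eq_mul_add_neg_mul {a u v : ℂ → ℂ} {A : ℂ}
    (ha : MeromorphicAt a 0) (hA : Tendsto (fun z : ℂ => z * a z) (𝓝[≠] 0) (𝓝 A))
    (hu : AnalyticAt ℂ u 0) (hv : AnalyticAt ℂ v 0) (huv : u 0 = v 0) :
    ∃ k : ℂ → ℂ, AnalyticAt ℂ k 0 ∧ ∀ z, z ≠ 0 → a z * u z + a (-z) * v z = k z := by
  obtain ⟨p, hp, hap⟩ := ha.exists_analyticAt_eq_div hA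
  have hpn : AnalyticAt ℂ (fun z => p (-z)) 0 :=
    AnalyticAt.fun_comp (g := p) (by simpa using hp) analyticAt_id.neg
  refine ⟨_, ((hp.fun_mul hu).fun_sub (hpn.fun_mul hv)).analyticAt_dslope, fun z hz => ?_⟩
  rw [dslope_of_ne _ hz, slope_def_field, hap z hz, hap (-z) (neg_ne_zero.mpr hz)]
  simp only [neg_zero, huv, sub_self, sub_zero]
  field_simp
  ring

/-- **Corollary of Lemma 2.2 (Chalykh).** Suppose the three-term difference operator
`D f z = a z * f (z + 2γ) + b z * f (z - 2γ) + c z * f z` is invariant under `z ↦ -z`,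
i.e. `b z = a (-z)` and `c (-z) = c z`, the coefficients `a`, `c` are meromorphic on `ℂ`,
`c` is analytic on `2γℤ`, `a` is analytic at nonzero points of `2γℤ` with at most a simple
pole at `0`, and `a (2γm) = 0`.  Then `D` preserves the space `Q_m` of meromorphic
functions that are analytic at points of `2γℤ` and satisfy `f (2jγ) = f (-2jγ)` for
`j = 1, …, m`. -/
theorem ruijsenaars_BC1_corollary_Qm_invariance_symmetric
    (γ : ℂ) (hγ : γ ≠ 0) (m : ℕ) (hm : 1 ≤ m)
    (a b c : ℂ → ℂ)
    (haM : ∀ z : ℂ, MeromorphicAt a z)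
    (hcM : ∀ z : ℂ, MeromorphicAt c z)
    (hb : ∀ z : ℂ, b z = a (-z))
    (hceven : ∀ z : ℂ, c (-z) = c z)
    (hcA : ∀ n : ℤ, AnalyticAt ℂ c (2 * γ * n))
    (haA : ∀ n : ℤ, n ≠ 0 → AnalyticAt ℂ a (2 * γ * n))
    (haPole : ∃ A : ℂ, Tendsto (fun z : ℂ => z * a z) (𝓝[≠] 0) (𝓝 A))
    (ham : a (2 * γ * (m : ℂ)) = 0) :
    ∀ f : ℂ → ℂ,
      (∀ z : ℂ, MeromorphicAt f z) →
      (∀ n : ℤ, AnalyticAt ℂ f (2 * γ * n)) →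
      (∀ j : ℕ, 1 ≤ j → j ≤ m → f (2 * (j : ℂ) * γ) = f (-(2 * (j : ℂ) * γ))) →
      ∃ g : ℂ → ℂ,
        (∀ z : ℂ, (¬∃ n : ℤ, z = 2 * γ * n) →
          g z = a z * f (z + 2 * γ) + b z * f (z - 2 * γ) + c z * f z) ∧
        (∀ z : ℂ, MeromorphicAt g z) ∧
        (∀ n : ℤ, AnalyticAt ℂ g (2 * γ * n)) ∧
        (∀ j : ℕ, 1 ≤ j → j ≤ m → g (2 * (j : ℂ) * γ) = g (-(2 * (j : ℂ) * γ))) := by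
  intro f hfM hfA hfsym
  obtain ⟨A, hA⟩ := haPole
  obtain rfl : b = fun z => a (-z) := funext hb
  have hadd (w z : ℂ) : AnalyticAt ℂ (fun z => z + w) z := analyticAt_id.add analyticAt_const
  have hfadd (w z : ℂ) (h : AnalyticAt ℂ f (z + w)) : AnalyticAt ℂ (fun z => f (z + w)) z :=
    AnalyticAt.fun_comp (g := f) h (hadd w z)
  have hfp (n : ℤ) : AnalyticAt ℂ (fun z => f (z + 2 * γ)) (2 * γ * n) := by
    refine hfadd _ _ ?_
    convert hfA (n + 1) using 1
    push_cast
    ring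
  have hfm (n : ℤ) : AnalyticAt ℂ (fun z => f (z - 2 * γ)) (2 * γ * n) := by
    simp only [sub_eq_add_neg]
    refine hfadd _ _ ?_
    convert hfA (n - 1) using 1
    push_cast
    ring
  have hf1 : f (0 + 2 * γ) = f (0 - 2 * γ) := by simpa using hfsym 1 le_rfl hm
  obtain ⟨k, hk, hkeq⟩ := exists_analyticAt_eq_mul_add_neg_mul (haM 0) hA
    (by simpa using hfp 0) (by simpa using hfm 0) hf1
  set h : ℂ → ℂ := fun z => a z * f (z + 2 * γ) + a (-z) * f (z - 2 * γ) + c z * f z with hdef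
  have hcf (n : ℤ) : AnalyticAt ℂ (fun z => c z * f z) (2 * γ * n) := (hcA n).fun_mul (hfA n)
  have hhM (z : ℂ) : MeromorphicAt h z := by
    refine ((MeromorphicAt.fun_mul (haM z) ?_).fun_add (MeromorphicAt.fun_mul ?_ ?_)).fun_add
      ((hcM z).fun_mul (hfM z))
    · exact MeromorphicAt.comp_analyticAt (f := f) (hfM _) (hadd _ _)
    · exact MeromorphicAt.comp_analyticAt (f := a) (haM _) analyticAt_id.neg
    · exact MeromorphicAt.comp_analyticAt (f := f) (hfM _) (analyticAt_id.sub analyticAt_const)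
  have hlat {n : ℤ} (hn : n ≠ 0) : 2 * γ * (n : ℂ) ≠ 0 := by simp [hγ, hn]
  have hg (z : ℂ) (hz : z ≠ 0) : Function.update h 0 (k 0 + c 0 * f 0) z = h z :=
    Function.update_of_ne hz _ _
  refine ⟨Function.update h 0 (k 0 + c 0 * f 0), fun z hz => hg z ?_, fun z => ?_, fun n => ?_,
    fun j hj hjm => ?_⟩
  · rintro rfl
    exact hz ⟨0, by simp⟩
  · refine (hhM z).congr ?_
    rcases eq_or_ne z 0 with rfl | hz
    · exact eventually_mem_nhdsWithin.mono fun w hw => (hg w hw).symm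
    · exact ((eventually_ne_nhds hz).filter_mono nhdsWithin_le_nhds).mono fun w hw => (hg w hw).symm
  · rcases eq_or_ne n 0 with rfl | hn
    · have hcf0 := hcf 0
      simp only [Int.cast_zero, mul_zero] at hcf0 ⊢
      convert hk.fun_add hcf0 using 1
      funext z
      rcases eq_or_ne z 0 with rfl | hz
      · simp
      · rw [hg z hz, hdef, ← hkeq z hz]
    · have han : AnalyticAt ℂ (fun z => a (-z)) (2 * γ * n) := by
        refine AnalyticAt.fun_comp (g := a) ?_ analyticAt_id.neg
        simpa using haA (-n) (neg_ne_zero.mpr hn)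
      refine AnalyticAt.congr ((((haA n hn).fun_mul (hfp n)).fun_add
        (han.fun_mul (hfm n))).fun_add (hcf n)) ?_
      exact (eventually_ne_nhds (hlat hn)).mono fun w hw => (hg w hw).symm
  · have hjz : 2 * (j : ℂ) * γ ≠ 0 := by
      simp [hγ, Nat.one_le_iff_ne_zero.mp hj]
    rw [hg _ hjz, hg _ (neg_ne_zero.mpr hjz)]
    have hdown : f (2 * (j : ℂ) * γ - 2 * γ) = f (-(2 * (j : ℂ) * γ) + 2 * γ) := by
      rcases hj.eq_or_lt with rfl | hj1
      · simp
      · have := hfsym (j - 1) (by omega) (by omega)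
        rw [Nat.cast_sub hj] at this
        convert this using 2 <;> push_cast <;> ring
    have hup : a (2 * (j : ℂ) * γ) * f (2 * (j : ℂ) * γ + 2 * γ) =
        a (2 * (j : ℂ) * γ) * f (-(2 * (j : ℂ) * γ) - 2 * γ) := by
      rcases hjm.eq_or_lt with rfl | hjm
      · rw [show 2 * (j : ℂ) * γ = 2 * γ * j by ring, ham, zero_mul, zero_mul]
      · have := hfsym (j + 1) (by omega) (by omega)
        congr 1
        convert this using 2 <;> push_cast <;> ring
    simp only [hdef, neg_neg, hceven, hdown, hup, hfsym j hj hjm]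
    ring
end

section
/- Assume: a, b, c are meromorphic on ℂ; a is analytic at every point of γ + 2γℤ except for at most a simple pole at −γ; b is analytic at every point of γ + 2γℤ except for at most a simple pole at γ; c is analytic at every point of γ + 2γℤ except for at most simple poles at γ and −γ; a + c extends analytically at −γ (i.e. lim_{z→−γ}(z+γ)·(a(z)+c(z)) = 0); b + c extends analytically at γ; the residues of a at −γ and of b at γ are opposite, i.e. lim_{z→−γ}(z+γ)·a(z) = −lim_{z→γ}(z−γ)·b(z); the analytic extensions of a + b + c at −γ and at γ take equal values; a((2m−1)γ) = 0; a((2j−1)γ) = b((1−2j)γ) for j = ±1, …, ±m; and c((2j+1)γ) = c(−(2j+1)γ) for j = 1, …, m−1. Then D(Q′_m) ⊆ Q′_m: for every f ∈ Q′_m the function Df extends analytically to every point of γ + 2γℤ, and its extension g satisfies g((2j−1)γ) = g((1−2j)γ) for j = 1, …, m. -/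
open Filter Topology

/-- A meromorphic function with finite limits along a set without accumulation points extends
analytically to that set. -/
lemma exists_analyticAt_extension {S : Set ℂ} (hS : ∀ p : ℂ, ∀ᶠ z in 𝓝[≠] p, z ∉ S)
    {h : ℂ → ℂ} (hh : ∀ z, MeromorphicAt h z)
    (hlim : ∀ p ∈ S, ∃ l, Tendsto h (𝓝[≠] p) (𝓝 l)) :
    ∃ g : ℂ → ℂ, (∀ z, z ∉ S → g z = h z) ∧
      (∀ p ∈ S, Tendsto h (𝓝[≠] p) (𝓝 (g p))) ∧
      (∀ z, MeromorphicAt g z) ∧ ∀ p ∈ S, AnalyticAt ℂ g p := by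
  classical
  choose! L hL using hlim
  let g : ℂ → ℂ := fun z => if z ∈ S then L z else h z
  have hgS : ∀ p ∈ S, g p = L p := fun p hp => if_pos hp
  have hg : ∀ z, z ∉ S → g z = h z := fun z hz => if_neg hz
  have heq : ∀ p, h =ᶠ[𝓝[≠] p] g := fun p => by
    filter_upwards [hS p] with z hz using (hg z hz).symm
  have hmero : ∀ z, MeromorphicAt g z := fun z => (hh z).congr (heq z)
  refine ⟨g, hg, fun p hp => hgS p hp ▸ hL p hp, hmero, fun p hp => (hmero p).analyticAt ?_⟩
  rw [continuousAt_iff_punctured_nhds, hgS p hp]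
  exact (hL p hp).congr' (heq p)

lemma eventually_notMem_arithmetic_progression {w : ℂ} (hw : w ≠ 0) (u p : ℂ) :
    ∀ᶠ z in 𝓝[≠] p, z ∉ {z : ℂ | ∃ n : ℤ, z = u + w * n} := by
  have hclosed : IsClosed ((fun z : ℂ => (z - u) / w) ⁻¹'
      ((fun n : ℤ => (n : ℂ)) '' {n : ℤ | u + w * n ≠ p})) :=
    (Complex.isClosedEmbedding_intCast.isClosedMap _ (isClosed_discrete _)).preimage
      (by fun_prop)
  have hp : p ∉ (fun z : ℂ => (z - u) / w) ⁻¹'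
      ((fun n : ℤ => (n : ℂ)) '' {n : ℤ | u + w * n ≠ p}) := by
    rintro ⟨n, hn, h⟩
    apply hn
    simp only at h
    rw [h]
    field_simp
    ring
  filter_upwards [nhdsWithin_le_nhds (hclosed.isOpen_compl.mem_nhds hp), self_mem_nhdsWithin]
    with z hz hzp
  rintro ⟨n, rfl⟩
  refine hz ⟨n, hzp, ?_⟩
  simp only
  field_simp
  ring

lemma tendsto_mul_of_simple_pole_of_zero {b u : ℂ → ℂ} {p r : ℂ}
    (hb : Tendsto (fun z => (z - p) * b z) (𝓝[≠] p) (𝓝 r))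
    (hu : DifferentiableAt ℂ u p) (hup : u p = 0) :
    Tendsto (fun z => b z * u z) (𝓝[≠] p) (𝓝 (r * deriv u p)) := by
  refine (hb.mul (hasDerivAt_iff_tendsto_slope.1 hu.hasDerivAt)).congr' ?_
  filter_upwards [self_mem_nhdsWithin] with z hz
  have : z - p ≠ 0 := sub_ne_zero.2 hz
  rw [slope_def_field, hup]
  field_simp
  ring

/-- The limit of `α z * f (z + s) + β z * f (z + t) + c z * f z` at `p`, where `β` has a simple
pole cancelled by that of `c` because `f (p + t) = f p`. -/
lemma tendsto_three_term_of_simple_pole {α β c f : ℂ → ℂ} {p s t r v : ℂ}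
    (hα : ContinuousAt α p) (hfs : ContinuousAt f (p + s))
    (hft : DifferentiableAt ℂ f (p + t)) (hf : DifferentiableAt ℂ f p)
    (hβ : Tendsto (fun z => (z - p) * β z) (𝓝[≠] p) (𝓝 r))
    (hv : Tendsto (fun z => α z + β z + c z) (𝓝[≠] p) (𝓝 v)) (hfp : f (p + t) = f p) :
    Tendsto (fun z => α z * f (z + s) + β z * f (z + t) + c z * f z) (𝓝[≠] p)
      (𝓝 (v * f p + α p * (f (p + s) - f p) + r * (deriv f (p + t) - deriv f p))) := by
  have hft' : DifferentiableAt ℂ (fun z => f (z + t)) p :=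
    DifferentiableAt.comp p (f := fun z => z + t) hft (by fun_prop)
  have hfs' : ContinuousAt (fun z => f (z + s)) p :=
    ContinuousAt.comp (f := fun z => z + s) hfs (by fun_prop)
  have hpole := tendsto_mul_of_simple_pole_of_zero (u := fun z => f (z + t) - f z) hβ
    (hft'.sub hf) (by simp [hfp])
  rw [deriv_fun_sub hft' hf, deriv_comp_add_const] at hpole
  have hreg : ContinuousAt (fun z => α z * (f (z + s) - f z)) p :=
    hα.mul (hfs'.sub hf.continuousAt)
  refine (((hv.mul (hf.continuousAt.tendsto.mono_left nhdsWithin_le_nhds)).add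
    (hreg.tendsto.mono_left nhdsWithin_le_nhds)).add hpole).congr fun z => ?_
  ring

/-- **Lemma 2.3 (Chalykh).** Let `D f z = a z * f (z + 2γ) + b z * f (z - 2γ) + c z * f z`
be a three-term difference operator with meromorphic coefficients, where on `γ + 2γℤ`:
`a` is analytic except for at most a simple pole at `-γ`, `b` is analytic except for at
most a simple pole at `γ`, `c` is analytic except for at most simple poles at `±γ`;
`a + c` extends analytically at `-γ`, `b + c` extends analytically at `γ`, the residues of
`a` at `-γ` and of `b` at `γ` are opposite, the analytic extensions of `a + b + c` at `-γ`
and at `γ` take equal values, `a ((2m-1)γ) = 0`, `a ((2j-1)γ) = b ((1-2j)γ)` for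
`j = ±1, …, ±m` and `c ((2j+1)γ) = c (-(2j+1)γ)` for `j = 1, …, m-1`.  Then `D` preserves
the space `Q'_m` of meromorphic functions analytic at points of `γ + 2γℤ` satisfying
`f ((2j-1)γ) = f ((1-2j)γ)` for `j = 1, …, m`. -/
theorem ruijsenaars_BC1_lemma_Qm'_invariance
    (γ : ℂ) (hγ : γ ≠ 0) (m : ℕ) (hm : 1 ≤ m)
    (a b c : ℂ → ℂ)
    (haM : ∀ z : ℂ, MeromorphicAt a z)
    (hbM : ∀ z : ℂ, MeromorphicAt b z)
    (hcM : ∀ z : ℂ, MeromorphicAt c z)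
    (haA : ∀ n : ℤ, n ≠ -1 → AnalyticAt ℂ a (γ + 2 * γ * n))
    (haPole : ∃ A : ℂ, Tendsto (fun z : ℂ => (z + γ) * a z) (𝓝[≠] (-γ)) (𝓝 A))
    (hbA : ∀ n : ℤ, n ≠ 0 → AnalyticAt ℂ b (γ + 2 * γ * n))
    (hbPole : ∃ B : ℂ, Tendsto (fun z : ℂ => (z - γ) * b z) (𝓝[≠] γ) (𝓝 B))
    (hcA : ∀ n : ℤ, n ≠ 0 → n ≠ -1 → AnalyticAt ℂ c (γ + 2 * γ * n))
    (hcPoleNeg : ∃ C₁ : ℂ, Tendsto (fun z : ℂ => (z + γ) * c z) (𝓝[≠] (-γ)) (𝓝 C₁))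
    (hcPolePos : ∃ C₂ : ℂ, Tendsto (fun z : ℂ => (z - γ) * c z) (𝓝[≠] γ) (𝓝 C₂))
    (hac : Tendsto (fun z : ℂ => (z + γ) * (a z + c z)) (𝓝[≠] (-γ)) (𝓝 0))
    (hbc : Tendsto (fun z : ℂ => (z - γ) * (b z + c z)) (𝓝[≠] γ) (𝓝 0))
    (hres : ∃ ra rb : ℂ,
      Tendsto (fun z : ℂ => (z + γ) * a z) (𝓝[≠] (-γ)) (𝓝 ra) ∧
      Tendsto (fun z : ℂ => (z - γ) * b z) (𝓝[≠] γ) (𝓝 rb) ∧ ra = -rb)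
    (hval : ∃ v : ℂ,
      Tendsto (fun z : ℂ => a z + b z + c z) (𝓝[≠] (-γ)) (𝓝 v) ∧
      Tendsto (fun z : ℂ => a z + b z + c z) (𝓝[≠] γ) (𝓝 v))
    (ham : a ((2 * (m : ℂ) - 1) * γ) = 0)
    (hab : ∀ j : ℤ, j ≠ 0 → |j| ≤ (m : ℤ) →
      a ((2 * (j : ℂ) - 1) * γ) = b ((1 - 2 * (j : ℂ)) * γ))
    (hcc : ∀ j : ℕ, 1 ≤ j → j ≤ m - 1 →
      c ((2 * (j : ℂ) + 1) * γ) = c (-((2 * (j : ℂ) + 1) * γ))) :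
    ∀ f : ℂ → ℂ,
      (∀ z : ℂ, MeromorphicAt f z) →
      (∀ n : ℤ, AnalyticAt ℂ f (γ + 2 * γ * n)) →
      (∀ j : ℕ, 1 ≤ j → j ≤ m → f ((2 * (j : ℂ) - 1) * γ) = f ((1 - 2 * (j : ℂ)) * γ)) →
      ∃ g : ℂ → ℂ,
        (∀ z : ℂ, (¬∃ n : ℤ, z = γ + 2 * γ * n) →
          g z = a z * f (z + 2 * γ) + b z * f (z - 2 * γ) + c z * f z) ∧
        (∀ z : ℂ, MeromorphicAt g z) ∧
        (∀ n : ℤ, AnalyticAt ℂ g (γ + 2 * γ * n)) ∧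
        (∀ j : ℕ, 1 ≤ j → j ≤ m →
          g ((2 * (j : ℂ) - 1) * γ) = g ((1 - 2 * (j : ℂ)) * γ)) := by
  intro f hfM hfA hfS
  obtain ⟨ra, rb, hra, hrb, rfl⟩ := hres
  obtain ⟨v, hvn, hvp⟩ := hval
  have h2γ : 2 * γ ≠ 0 := mul_ne_zero two_ne_zero hγ
  have haR : ∀ n : ℤ, n ≠ -1 → AnalyticAt ℂ a ((2 * n + 1) * γ) := fun n hn => by
    convert haA n hn using 1; ring
  have hbR : ∀ n : ℤ, n ≠ 0 → AnalyticAt ℂ b ((2 * n + 1) * γ) := fun n hn => by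
    convert hbA n hn using 1; ring
  have hcR : ∀ n : ℤ, n ≠ 0 → n ≠ -1 → AnalyticAt ℂ c ((2 * n + 1) * γ) := fun n h0 h1 => by
    convert hcA n h0 h1 using 1; ring
  have hfR : ∀ n : ℤ, AnalyticAt ℂ f ((2 * n + 1) * γ) := fun n => by
    convert hfA n using 1; ring
  have hfγ : AnalyticAt ℂ f γ := by simpa using hfR 0
  have hfnγ : AnalyticAt ℂ f (-γ) := by convert hfR (-1) using 1; push_cast; ring
  have hf1 : f γ = f (-γ) := by
    convert hfS 1 le_rfl hm using 2 <;> push_cast <;> ring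
  let h : ℂ → ℂ := fun z => a z * f (z + 2 * γ) + b z * f (z - 2 * γ) + c z * f z
  have hshift : ∀ s z, MeromorphicAt (fun z => f (z + s)) z := fun s z =>
    (hfM (z + s)).comp_analyticAt (g := fun z => z + s) (by fun_prop)
  have hhM : ∀ z, MeromorphicAt h z := fun z => by
    refine (((haM z).mul (hshift (2 * γ) z)).add ((hbM z).mul ?_)).add ((hcM z).mul (hfM z))
    simpa only [sub_eq_add_neg] using hshift (-(2 * γ)) z
  have hpos : Tendsto h (𝓝[≠] γ)
      (𝓝 (v * f γ + a γ * (f (3 * γ) - f γ) + rb * (deriv f (-γ) - deriv f γ))) := by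
    have e1 : γ + 2 * γ = 3 * γ := by ring
    have e2 : γ + -(2 * γ) = -γ := by ring
    have := tendsto_three_term_of_simple_pole (α := a) (β := b) (c := c) (f := f) (p := γ)
      (s := 2 * γ) (t := -(2 * γ)) (r := rb) (v := v)
      (by simpa using (haR 0 (by norm_num)).continuousAt)
      (by convert (hfR 1).continuousAt using 1; push_cast; ring)
      (by rw [e2]; exact hfnγ.differentiableAt) hfγ.differentiableAt hrb hvp
      (by rw [e2, hf1])
    rw [e1, e2] at this
    simpa only [h, sub_eq_add_neg] using this
  have hneg : Tendsto h (𝓝[≠] (-γ))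
      (𝓝 (v * f (-γ) + b (-γ) * (f (-(3 * γ)) - f (-γ)) +
        -rb * (deriv f γ - deriv f (-γ)))) := by
    have e1 : -γ + -(2 * γ) = -(3 * γ) := by ring
    have e2 : -γ + 2 * γ = γ := by ring
    have := tendsto_three_term_of_simple_pole (α := b) (β := a) (c := c) (f := f) (p := -γ)
      (s := -(2 * γ)) (t := 2 * γ) (r := -rb) (v := v)
      (by convert (hbR (-1) (by norm_num)).continuousAt using 1; push_cast; ring)
      (by convert (hfR (-2)).continuousAt using 1; push_cast; ring)
      (by rw [e2]; exact hfγ.differentiableAt) hfnγ.differentiableAt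
      (by simpa only [sub_neg_eq_add] using hra)
      (hvn.congr fun z => by ring) (by rw [e2, hf1])
    rw [e1, e2] at this
    refine this.congr fun z => ?_
    simp only [h, sub_eq_add_neg]
    ring
  have hreg : ∀ n : ℤ, n ≠ 0 → n ≠ -1 →
      Tendsto h (𝓝[≠] ((2 * n + 1) * γ)) (𝓝 (h ((2 * n + 1) * γ))) := fun n h0 h1 => by
    have hplus : ContinuousAt (fun z => f (z + 2 * γ)) ((2 * n + 1) * γ) := by
      refine ContinuousAt.comp (f := fun z => z + 2 * γ) ?_ (by fun_prop)
      convert (hfR (n + 1)).continuousAt using 1; push_cast; ring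
    have hminus : ContinuousAt (fun z => f (z - 2 * γ)) ((2 * n + 1) * γ) := by
      refine ContinuousAt.comp (f := fun z => z - 2 * γ) ?_ (by fun_prop)
      convert (hfR (n - 1)).continuousAt using 1; push_cast; ring
    have hcont : ContinuousAt h ((2 * n + 1) * γ) :=
      (((haR n h1).continuousAt.mul hplus).add ((hbR n h0).continuousAt.mul hminus)).add
        ((hcR n h0 h1).continuousAt.mul (hfR n).continuousAt)
    exact hcont.tendsto.mono_left nhdsWithin_le_nhds
  obtain ⟨g, hg, hgL, hgM, hgA⟩ := exists_analyticAt_extension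
    (eventually_notMem_arithmetic_progression h2γ γ) hhM (by
      rintro _ ⟨n, rfl⟩
      have e : γ + 2 * γ * n = (2 * n + 1) * γ := by ring
      by_cases h0 : n = 0
      · subst h0; simpa using ⟨_, hpos⟩
      by_cases h1 : n = -1
      · subst h1
        rw [e, show (2 * ((-1 : ℤ) : ℂ) + 1) * γ = -γ by push_cast; ring]
        exact ⟨_, hneg⟩
      · rw [e]; exact ⟨_, hreg n h0 h1⟩)
  refine ⟨g, hg, hgM, fun n => hgA _ ⟨n, rfl⟩, fun j hj hjm => ?_⟩
  have habj := hab j (by omega) (by rw [abs_of_nonneg] <;> omega)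
  push_cast at habj
  have houter : a ((2 * (j : ℂ) - 1) * γ) * f ((2 * (j : ℂ) + 1) * γ) =
      a ((2 * (j : ℂ) - 1) * γ) * f (-((2 * (j : ℂ) + 1) * γ)) := by
    rcases hjm.eq_or_lt with rfl | hlt
    · rw [ham, zero_mul, zero_mul]
    · have := hfS (j + 1) (by omega) hlt
      push_cast at this
      rw [show (2 * (j : ℂ) + 1) * γ = (2 * ((j : ℂ) + 1) - 1) * γ by ring, this]
      congr 2; ring
  rcases hj.eq_or_lt with rfl | hj1
  · have eγ : (2 * ((1 : ℕ) : ℂ) - 1) * γ = γ := by push_cast; ring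
    have enγ : (1 - 2 * ((1 : ℕ) : ℂ)) * γ = -γ := by push_cast; ring
    have e3γ : (2 * ((1 : ℕ) : ℂ) + 1) * γ = 3 * γ := by push_cast; ring
    rw [eγ, enγ] at habj ⊢
    rw [eγ, e3γ] at houter
    rw [tendsto_nhds_unique (hgL γ ⟨0, by simp⟩) hpos,
      tendsto_nhds_unique (hgL (-γ) ⟨-1, by push_cast; ring⟩) hneg, ← habj, ← hf1]
    linear_combination houter
  · have hp := hreg (j - 1) (by omega) (by omega)
    have hn := hreg (-j) (by omega) (by omega)
    rw [show (2 * (((j : ℤ) - 1 : ℤ) : ℂ) + 1) * γ = (2 * (j : ℂ) - 1) * γ by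
      push_cast; ring] at hp
    rw [show (2 * ((-(j : ℤ) : ℤ) : ℂ) + 1) * γ = (1 - 2 * (j : ℂ)) * γ by
      push_cast; ring] at hn
    rw [tendsto_nhds_unique (hgL _ ⟨j - 1, by push_cast; ring⟩) hp,
      tendsto_nhds_unique (hgL _ ⟨-j, by push_cast; ring⟩) hn]
    have habn := hab (1 - j) (by omega) (by rw [abs_le]; omega)
    have hcj := hcc (j - 1) (by omega) (by omega)
    have hfj := hfS j hj hjm
    have hfj1 := hfS (j - 1) (by omega) (by omega)
    rw [Nat.cast_sub hj, Nat.cast_one] at hcj hfj1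
    push_cast at habn
    rw [show (2 * (1 - (j : ℂ)) - 1) * γ = (1 - 2 * (j : ℂ)) * γ by ring,
      show (1 - 2 * (1 - (j : ℂ))) * γ = (2 * (j : ℂ) - 1) * γ by ring] at habn
    rw [show (2 * ((j : ℂ) - 1) + 1) * γ = (2 * (j : ℂ) - 1) * γ by ring,
      show -((2 * (j : ℂ) - 1) * γ) = (1 - 2 * (j : ℂ)) * γ by ring] at hcj
    simp only [h]
    rw [show (2 * (j : ℂ) - 1) * γ + 2 * γ = (2 * (j : ℂ) + 1) * γ by ring,
      show (2 * (j : ℂ) - 1) * γ - 2 * γ = (2 * ((j : ℂ) - 1) - 1) * γ by ring,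
      show (1 - 2 * (j : ℂ)) * γ + 2 * γ = (1 - 2 * ((j : ℂ) - 1)) * γ by ring,
      show (1 - 2 * (j : ℂ)) * γ - 2 * γ = -((2 * (j : ℂ) + 1) * γ) by ring,
      houter, habn, hcj, hfj, hfj1, habj]
    ring
end

section
/- Assume: a and c are meromorphic on ℂ; a is analytic at every point of γ + 2γℤ except for at most a simple pole at −γ; c is analytic at every point of γ + 2γℤ except for at most simple poles at γ and −γ; b(z) = a(−z) and c(−z) = c(z) for all z (so the operator D is invariant under z ↦ −z); a + c extends analytically at −γ (i.e. lim_{z→−γ}(z+γ)·(a(z)+c(z)) = 0); and a((2m−1)γ) = 0. Then D(Q′_m) ⊆ Q′_m: for every f ∈ Q′_m the function Df extends analytically to every point of γ + 2γℤ, and its extension g satisfies g((2j−1)γ) = g((1−2j)γ) for j = 1, …, m. -/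
open Filter Topology

/-- A meromorphic function with a limit at a point becomes analytic there once its value is
replaced by the limit. -/
theorem MeromorphicAt.analyticAt_update_of_tendsto {F : ℂ → ℂ} {p A : ℂ} (hF : MeromorphicAt F p)
    (hA : Tendsto F (𝓝[≠] p) (𝓝 A)) : AnalyticAt ℂ (Function.update F p A) p := by
  refine MeromorphicAt.analyticAt ?_ (continuousAt_update_same.2 hA)
  refine hF.congr ?_
  filter_upwards [self_mem_nhdsWithin] with z hz
  exact (Function.update_of_ne hz _ _).symm

/-- The quotient of an analytic function vanishing at `p` by `z - p` is analytic at `p`. -/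
theorem AnalyticAt.dslope_self {N : ℂ → ℂ} {p : ℂ} (hN : AnalyticAt ℂ N p) :
    AnalyticAt ℂ (dslope N p) p := by
  obtain ⟨q, hq⟩ := hN
  exact ⟨_, hq.has_fpower_series_dslope_fslope⟩

/-- If `B` and `C` have at most simple poles at `p` with opposite residues and `u p = v p`, then
`B * u + C * v` extends analytically to `p`; the extension vanishes at `p` if moreover `u` and `v`
both vanish there with the same derivative. -/
theorem exists_analyticAt_of_opposite_residues {B C u v : ℂ → ℂ} {p β κ : ℂ}
    (hB : MeromorphicAt B p) (hC : MeromorphicAt C p)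
    (hBp : Tendsto (fun z => (z - p) * B z) (𝓝[≠] p) (𝓝 β))
    (hCp : Tendsto (fun z => (z - p) * C z) (𝓝[≠] p) (𝓝 κ))
    (hres : β + κ = 0) (hu : AnalyticAt ℂ u p) (hv : AnalyticAt ℂ v p) (huv : u p = v p) :
    ∃ G : ℂ → ℂ, AnalyticAt ℂ G p ∧ (∀ᶠ z in 𝓝[≠] p, B z * u z + C z * v z = G z) ∧
      (u p = 0 → deriv u p = deriv v p → G p = 0) := by
  have hid : MeromorphicAt (fun z : ℂ => z - p) p := by fun_prop
  have hb := (hid.mul hB).analyticAt_update_of_tendsto hBp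
  have hc := (hid.mul hC).analyticAt_update_of_tendsto hCp
  set b' := Function.update ((fun z : ℂ => z - p) * B) p β with hb'
  set c' := Function.update ((fun z : ℂ => z - p) * C) p κ with hc'
  have hbp : b' p = β := by simp [hb']
  have hcp : c' p = κ := by simp [hc']
  have hN : AnalyticAt ℂ (b' * u + c' * v) p := (hb.mul hu).add (hc.mul hv)
  have hN0 : (b' * u + c' * v) p = 0 := by
    simp only [Pi.add_apply, Pi.mul_apply, hbp, hcp, huv]
    linear_combination v p * hres
  refine ⟨dslope (b' * u + c' * v) p, hN.dslope_self, ?_, ?_⟩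
  · filter_upwards [self_mem_nhdsWithin] with z hz
    have hz' : z - p ≠ 0 := sub_ne_zero.2 hz
    have e1 : b' z = (z - p) * B z := by rw [hb', Function.update_of_ne hz]; rfl
    have e2 : c' z = (z - p) * C z := by rw [hc', Function.update_of_ne hz]; rfl
    rw [dslope_of_ne _ hz, slope_def_field, hN0]
    simp only [Pi.add_apply, Pi.mul_apply, e1, e2]
    field_simp
    ring
  · intro hu0 hd
    have h := ((hb.differentiableAt.hasDerivAt.mul hu.differentiableAt.hasDerivAt).add
      (hc.differentiableAt.hasDerivAt.mul hv.differentiableAt.hasDerivAt)).deriv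
    rw [dslope_same, h, hbp, hcp, ← huv, hu0, hd]
    linear_combination deriv v p * hres

/-- The lattice coset `γ + 2γℤ` has no accumulation point. -/
theorem eventually_not_mem_odd_multiples {γ : ℂ} (hγ : γ ≠ 0) (p : ℂ) :
    ∀ᶠ z in 𝓝[≠] p, ¬∃ n : ℤ, z = γ + 2 * γ * n := by
  have hd : HasDerivAt (fun z : ℂ => Complex.exp (z * (Real.pi * Complex.I / γ)))
      (Complex.exp (p * (Real.pi * Complex.I / γ)) * (1 * (Real.pi * Complex.I / γ))) p :=
    ((hasDerivAt_id p).mul_const _).cexp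
  have hne : Complex.exp (p * (Real.pi * Complex.I / γ)) * (1 * (Real.pi * Complex.I / γ)) ≠ 0 := by
    have := Real.pi_ne_zero
    simp [Complex.exp_ne_zero, hγ, this]
  filter_upwards [hd.eventually_ne hne (c := -1)] with z hz
  rintro ⟨n, rfl⟩
  apply hz
  have : (γ + 2 * γ * n) * (Real.pi * Complex.I / γ)
      = Real.pi * Complex.I + n * (2 * Real.pi * Complex.I) := by
    field_simp
  rw [this, Complex.exp_add, Complex.exp_int_mul_two_pi_mul_I, Complex.exp_pi_mul_I, mul_one]

/-- **Corollary of Lemma 2.3 (Chalykh).** Suppose the three-term difference operator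
`D f z = a z * f (z + 2γ) + b z * f (z - 2γ) + c z * f z` is invariant under `z ↦ -z`,
i.e. `b z = a (-z)` and `c (-z) = c z`, the coefficients `a`, `c` are meromorphic on `ℂ`,
`a` is analytic at points of `γ + 2γℤ` except for at most a simple pole at `-γ`, `c` is
analytic at points of `γ + 2γℤ` except for at most simple poles at `±γ`, `a + c` extends
analytically at `-γ`, and `a ((2m-1)γ) = 0`.  Then `D` preserves the space `Q'_m` of
meromorphic functions analytic at points of `γ + 2γℤ` satisfying
`f ((2j-1)γ) = f ((1-2j)γ)` for `j = 1, …, m`. -/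
theorem ruijsenaars_BC1_corollary_Qm'_invariance_symmetric
    (γ : ℂ) (hγ : γ ≠ 0) (m : ℕ) (hm : 1 ≤ m)
    (a b c : ℂ → ℂ)
    (haM : ∀ z : ℂ, MeromorphicAt a z)
    (hcM : ∀ z : ℂ, MeromorphicAt c z)
    (hb : ∀ z : ℂ, b z = a (-z))
    (hceven : ∀ z : ℂ, c (-z) = c z)
    (haA : ∀ n : ℤ, n ≠ -1 → AnalyticAt ℂ a (γ + 2 * γ * n))
    (haPole : ∃ A : ℂ, Tendsto (fun z : ℂ => (z + γ) * a z) (𝓝[≠] (-γ)) (𝓝 A))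
    (hcA : ∀ n : ℤ, n ≠ 0 → n ≠ -1 → AnalyticAt ℂ c (γ + 2 * γ * n))
    (hcPoleNeg : ∃ C₁ : ℂ, Tendsto (fun z : ℂ => (z + γ) * c z) (𝓝[≠] (-γ)) (𝓝 C₁))
    (hcPolePos : ∃ C₂ : ℂ, Tendsto (fun z : ℂ => (z - γ) * c z) (𝓝[≠] γ) (𝓝 C₂))
    (hac : Tendsto (fun z : ℂ => (z + γ) * (a z + c z)) (𝓝[≠] (-γ)) (𝓝 0))
    (ham : a ((2 * (m : ℂ) - 1) * γ) = 0) :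
    ∀ f : ℂ → ℂ,
      (∀ z : ℂ, MeromorphicAt f z) →
      (∀ n : ℤ, AnalyticAt ℂ f (γ + 2 * γ * n)) →
      (∀ j : ℕ, 1 ≤ j → j ≤ m → f ((2 * (j : ℂ) - 1) * γ) = f ((1 - 2 * (j : ℂ)) * γ)) →
      ∃ g : ℂ → ℂ,
        (∀ z : ℂ, (¬∃ n : ℤ, z = γ + 2 * γ * n) →
          g z = a z * f (z + 2 * γ) + b z * f (z - 2 * γ) + c z * f z) ∧
        (∀ z : ℂ, MeromorphicAt g z) ∧
        (∀ n : ℤ, AnalyticAt ℂ g (γ + 2 * γ * n)) ∧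
        (∀ j : ℕ, 1 ≤ j → j ≤ m →
          g ((2 * (j : ℂ) - 1) * γ) = g ((1 - 2 * (j : ℂ)) * γ)) := by
  intro f hfM hfA hf
  obtain ⟨A, hA⟩ := haPole
  obtain ⟨C₁, hC₁⟩ := hcPoleNeg
  have hres : A + C₁ = 0 := by
    refine tendsto_nhds_unique (hA.add hC₁) (hac.congr fun z => ?_)
    ring
  have hneg (p : ℂ) : Tendsto (fun z : ℂ => -z) (𝓝[≠] p) (𝓝[≠] (-p)) := by
    refine tendsto_nhdsWithin_of_tendsto_nhds_of_eventually_within _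
      (continuous_neg.tendsto p |>.mono_left nhdsWithin_le_nhds) ?_
    filter_upwards [self_mem_nhdsWithin] with z hz
    simpa using hz
  have hbM (z : ℂ) : MeromorphicAt b z := by
    rw [funext hb]
    exact (haM (-z)).comp_analyticAt analyticAt_id.neg
  have hbA (n : ℤ) (hn : n ≠ 0) : AnalyticAt ℂ b (γ + 2 * γ * n) := by
    rw [funext hb]
    refine AnalyticAt.fun_comp (g := a) ?_ analyticAt_id.neg
    have := haA (-1 - n) (by omega)
    convert this using 1
    push_cast
    ring
  have hB : Tendsto (fun z => (z - γ) * b z) (𝓝[≠] γ) (𝓝 (-A)) := by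
    refine (hA.comp (hneg γ)).neg.congr fun z => ?_
    simp only [Function.comp, hb]
    ring
  have hC : Tendsto (fun z => (z - γ) * c z) (𝓝[≠] γ) (𝓝 (-C₁)) := by
    refine (hC₁.comp (hneg γ)).neg.congr fun z => ?_
    simp only [Function.comp, hceven]
    ring
  have hadd (F : ℂ → ℂ) (hF : ∀ n : ℤ, AnalyticAt ℂ F (γ + 2 * γ * n)) (n : ℤ) :
      AnalyticAt ℂ (fun z => F (z + 2 * γ)) (γ + 2 * γ * n) := by
    refine AnalyticAt.fun_comp (g := F) ?_ (by fun_prop)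
    convert hF (n + 1) using 1
    push_cast
    ring
  have hsub (F : ℂ → ℂ) (hF : ∀ n : ℤ, AnalyticAt ℂ F (γ + 2 * γ * n)) (n : ℤ) :
      AnalyticAt ℂ (fun z => F (z - 2 * γ)) (γ + 2 * γ * n) := by
    refine AnalyticAt.fun_comp (g := F) ?_ (by fun_prop)
    convert hF (n - 1) using 1
    push_cast
    ring
  have hf1 : f γ = f (-γ) := by
    have := hf 1 le_rfl hm
    norm_num at this
    exact this
  have hp0 : γ + 2 * γ * ((0 : ℤ) : ℂ) = γ := by simp
  have hpn : γ + 2 * γ * ((-1 : ℤ) : ℂ) = -γ := by push_cast; ring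
  set Df : ℂ → ℂ := fun z => a z * f (z + 2 * γ) + b z * f (z - 2 * γ) + c z * f z with hDf
  have hext (n : ℤ) : ∃ G : ℂ → ℂ, AnalyticAt ℂ G (γ + 2 * γ * n) ∧
      Df =ᶠ[𝓝[≠] (γ + 2 * γ * n)] G := by
    by_cases h0 : n = 0
    · subst h0
      have h1 := hsub f hfA 0
      have h2 := hfA 0
      have h3 := (haA 0 (by norm_num)).mul (hadd f hfA 0)
      rw [hp0] at h1 h2 h3 ⊢
      obtain ⟨G, hG, hGe, -⟩ := exists_analyticAt_of_opposite_residues (hbM γ) (hcM γ) hB hC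
        (by linear_combination -hres) h1 h2 (by rw [hf1]; congr 1; ring)
      refine ⟨_, h3.add hG, ?_⟩
      filter_upwards [hGe] with z hz
      simp only [hDf, Pi.add_apply, Pi.mul_apply, ← hz]
      ring
    by_cases h1 : n = -1
    · subst h1
      have h1 := hadd f hfA (-1)
      have h2 := hfA (-1)
      have h3 := (hbA (-1) (by norm_num)).mul (hsub f hfA (-1))
      rw [hpn] at h1 h2 h3 ⊢
      obtain ⟨G, hG, hGe, -⟩ := exists_analyticAt_of_opposite_residues (haM (-γ)) (hcM (-γ))
        (by simpa only [sub_neg_eq_add] using hA) (by simpa only [sub_neg_eq_add] using hC₁)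
        hres h1 h2 (by rw [← hf1]; congr 1; ring)
      refine ⟨_, h3.add hG, ?_⟩
      filter_upwards [hGe] with z hz
      simp only [hDf, Pi.add_apply, Pi.mul_apply, ← hz]
      ring
    · exact ⟨Df, (((haA n h1).mul (hadd f hfA n)).add ((hbA n h0).mul (hsub f hfA n))).add
        ((hcA n h0 h1).mul (hfA n)), EventuallyEq.rfl⟩
  classical
  let g : ℂ → ℂ := fun z => if ∃ n : ℤ, z = γ + 2 * γ * n then limUnder (𝓝[≠] z) Df else Df z
  have hgoff (z : ℂ) (hz : ¬∃ n : ℤ, z = γ + 2 * γ * n) : g z = Df z := if_neg hz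
  have hgD (p : ℂ) : Df =ᶠ[𝓝[≠] p] g :=
    (eventually_not_mem_odd_multiples hγ p).mono fun z hz => (hgoff z hz).symm
  have hgA (n : ℤ) : AnalyticAt ℂ g (γ + 2 * γ * n) := by
    obtain ⟨G, hG, hGe⟩ := hext n
    refine hG.congr ?_
    refine eventuallyEq_nhds_of_eventuallyEq_nhdsNE (hGe.symm.trans (hgD _)) ?_
    have hlim : Tendsto Df (𝓝[≠] (γ + 2 * γ * n)) (𝓝 (G (γ + 2 * γ * n))) :=
      (hG.continuousAt.tendsto.mono_left nhdsWithin_le_nhds).congr' hGe.symm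
    exact (hlim.limUnder_eq.symm.trans (if_pos ⟨n, rfl⟩).symm)
  refine ⟨g, hgoff, fun z => ?_, hgA, ?_⟩
  · refine MeromorphicAt.congr ?_ (hgD z)
    have hp : MeromorphicAt (fun w => f (w + 2 * γ)) z :=
      (hfM (z + 2 * γ)).comp_analyticAt (g := fun w => w + 2 * γ) (by fun_prop)
    have hs : MeromorphicAt (fun w => f (w - 2 * γ)) z :=
      (hfM (z - 2 * γ)).comp_analyticAt (g := fun w => w - 2 * γ) (by fun_prop)
    exact (((haM z).mul hp).add ((hbM z).mul hs)).add ((hcM z).mul (hfM z))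
  intro j hj1 hjm
  set h : ℂ → ℂ := fun z => f z - f (-z) with hh
  have hodd (z : ℂ) : h (-z) = -h z := by simp [hh]
  have hhA (n : ℤ) : AnalyticAt ℂ h (γ + 2 * γ * n) := by
    refine (hfA n).sub (AnalyticAt.fun_comp (g := f) ?_ analyticAt_id.neg)
    convert hfA (-1 - n) using 1
    push_cast
    ring
  have hh0 (i : ℕ) (hi1 : 1 ≤ i) (him : i ≤ m) : h ((2 * (i : ℂ) - 1) * γ) = 0 := by
    simp only [hh, hf i hi1 him, sub_eq_zero]
    congr 1
    ring
  have hpj : (2 * (j : ℂ) - 1) * γ = γ + 2 * γ * ((j - 1 : ℤ) : ℂ) := by push_cast; ring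
  have hpj' : (1 - 2 * (j : ℂ)) * γ = -(γ + 2 * γ * ((j - 1 : ℤ) : ℂ)) := by push_cast; ring
  have hpj'' : (1 - 2 * (j : ℂ)) * γ = γ + 2 * γ * ((-j : ℤ) : ℂ) := by push_cast; ring
  have hup : a ((2 * (j : ℂ) - 1) * γ) * h ((2 * (j : ℂ) - 1) * γ + 2 * γ) = 0 := by
    rcases hjm.eq_or_lt with rfl | hlt
    · rw [ham, zero_mul]
    · have := hh0 (j + 1) (by omega) hlt
      rw [← mul_zero (a _), ← this]
      congr 2
      push_cast
      ring
  set p : ℂ := (2 * (j : ℂ) - 1) * γ with hp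
  have hpneg : (1 - 2 * (j : ℂ)) * γ = -p := by rw [hp]; ring
  have hDh : Tendsto (fun z => a z * h (z + 2 * γ) + b z * h (z - 2 * γ) + c z * h z)
      (𝓝[≠] p) (𝓝 0) := by
    have hl : Tendsto (fun z => a z * h (z + 2 * γ)) (𝓝[≠] p) (𝓝 0) := by
      have := ((haA (j - 1) (by omega)).mul (hadd h hhA (j - 1))).continuousAt.tendsto
      rw [← hpj] at this
      simp only [Pi.mul_apply, hup] at this
      exact this.mono_left nhdsWithin_le_nhds
    have hr : Tendsto (fun z => b z * h (z - 2 * γ) + c z * h z) (𝓝[≠] p) (𝓝 0) := by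
      rcases hj1.eq_or_lt with rfl | hlt
      · have hpγ : p = γ := by rw [hp]; push_cast; ring
        have hγ0 : h γ = 0 := by rw [← hpγ]; exact hh0 1 le_rfl hm
        have hγ1 : h (γ - 2 * γ) = 0 := by
          rw [show γ - 2 * γ = -γ by ring, hodd, hγ0, neg_zero]
        have h1 := hsub h hhA 0
        have h2 := hhA 0
        rw [hp0] at h1 h2
        obtain ⟨G, hG, hGe, hG0⟩ := exists_analyticAt_of_opposite_residues (hbM γ) (hcM γ) hB hC
          (by linear_combination -hres) h1 h2 (by rw [hγ0, hγ1])
        have hder : deriv (fun z => h (z - 2 * γ)) γ = deriv h γ := by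
          have e := deriv_comp_neg h γ
          rw [funext hodd, deriv.fun_neg] at e
          rw [deriv_comp_sub_const, show γ - 2 * γ = -γ by ring]
          exact (neg_injective e).symm
        rw [hpγ, ← hG0 hγ1 hder]
        exact (hG.continuousAt.tendsto.mono_left nhdsWithin_le_nhds).congr'
          (hGe.mono fun z hz => hz.symm)
      · have := (((hbA (j - 1) (by omega)).mul (hsub h hhA (j - 1))).add
          ((hcA (j - 1) (by omega) (by omega)).mul (hhA (j - 1)))).continuousAt.tendsto
        have hhp : h p = 0 := hh0 j hj1 hjm
        have e : h (p - 2 * γ) = 0 := by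
          have := hh0 (j - 1) (by omega) (by omega)
          rw [← this, Nat.cast_sub hj1]
          congr 1
          rw [hp]
          push_cast
          ring
        rw [← hpj] at this
        simp only [Pi.add_apply, Pi.mul_apply, e, hhp, mul_zero, add_zero] at this
        exact this.mono_left nhdsWithin_le_nhds
    have := hl.add hr
    rw [add_zero] at this
    exact this.congr fun z => by ring
  have hg1 : Tendsto g (𝓝[≠] p) (𝓝 (g p)) := by
    have := (hgA (j - 1)).continuousAt.tendsto
    rw [← hpj] at this
    exact this.mono_left nhdsWithin_le_nhds
  have hg2 : Tendsto g (𝓝[≠] (-p)) (𝓝 (g (-p))) := by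
    have := (hgA (-j)).continuousAt.tendsto
    rw [← hpj'', hpneg] at this
    exact this.mono_left nhdsWithin_le_nhds
  rw [hpneg, ← sub_eq_zero]
  refine tendsto_nhds_unique (hg1.sub (hg2.comp (hneg p))) (hDh.congr' ?_)
  filter_upwards [hgD p, (hneg p).eventually (hgD (-p))] with z hz hz'
  simp only [Function.comp, ← hz, ← hz', hDf, hh, hb, hceven, neg_neg]
  rw [show -(z + 2 * γ) = -z - 2 * γ by ring, show -(z - 2 * γ) = -z + 2 * γ by ring]
  ring
end

section
/- The BC₁ Ruijsenaars operator with integer coupling parameters preserves the spaces F^{α₁,α₂}_m: for any α₁, α₂ ∈ ℂ, any entire ψ ∈ F^{α₁,α₂}_m, any s ∈ {1, 2}, and any z ∈ ℂ such that both z and z + 2ω_s are regular for L, one has (Lψ)(z + 2ω_s) = exp(2mη_s·z + α_s)·(Lψ)(z). -/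
open Filter Topology

open Complex

/-- `f` is multiplied by `k * exp (2 * e * (z + w))` under the translation `z ↦ z + 2 * w`,
for some nonzero constant `k`. -/
def QuasiPeriodic (f : ℂ → ℂ) (w e : ℂ) : Prop :=
  ∃ k : ℂ, k ≠ 0 ∧ ∀ z, f (z + 2 * w) = k * exp (2 * e * (z + w)) * f z

namespace QuasiPeriodic

variable {f : ℂ → ℂ} {w e : ℂ}

/-- The translate `exp (-b * z) * f (z + t) / d` of a quasi-periodic function is quasi-periodic. -/
theorem translate (hf : QuasiPeriodic f w e) (b t d : ℂ) :
    QuasiPeriodic (fun z => exp (-b * z) * f (z + t) / d) w e := by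
  obtain ⟨k, hk, h⟩ := hf
  refine ⟨k * exp (2 * (e * t - b * w)), mul_ne_zero hk (exp_ne_zero _), fun z => ?_⟩
  have hexp : exp (-b * (z + 2 * w)) * exp (2 * e * (z + t + w)) =
      exp (2 * (e * t - b * w)) * exp (2 * e * (z + w)) * exp (-b * z) := by
    simp only [← exp_add]
    ring_nf
  have hshift : f (z + 2 * w + t) = k * exp (2 * e * (z + t + w)) * f (z + t) := by
    rw [← h, add_right_comm]
  simp only [hshift]
  linear_combination k * f (z + t) / d * hexp

theorem div_translate (hf : QuasiPeriodic f w e) (z u : ℂ) :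
    f (z + 2 * w - u) / f (z + 2 * w) = exp (-(2 * e * u)) * (f (z - u) / f z) := by
  obtain ⟨k, hk, h⟩ := hf
  have hexp : exp (2 * e * (z - u + w)) = exp (-(2 * e * u)) * exp (2 * e * (z + w)) := by
    rw [← exp_add]
    ring_nf
  have hne : k * exp (2 * e * (z + w)) ≠ 0 := mul_ne_zero hk (exp_ne_zero _)
  rw [add_sub_right_comm, h, h, hexp,
    show k * (exp (-(2 * e * u)) * exp (2 * e * (z + w))) * f (z - u) =
      k * exp (2 * e * (z + w)) * (exp (-(2 * e * u)) * f (z - u)) by ring,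
    mul_div_mul_left _ _ hne, mul_div_assoc]

theorem deriv_div (hf : QuasiPeriodic f w e) (hd : Differentiable ℂ f) {z : ℂ} (hz : f z ≠ 0) :
    deriv f (z + 2 * w) / f (z + 2 * w) = 2 * e + deriv f z / f z := by
  obtain ⟨k, hk, h⟩ := hf
  have hlin : HasDerivAt (fun z => 2 * e * (z + w)) (2 * e) z := by
    simpa using ((hasDerivAt_id z).add_const w).const_mul (2 * e)
  have hder : deriv f (z + 2 * w) =
      k * exp (2 * e * (z + w)) * (2 * e * f z + deriv f z) := by
    rw [← deriv_comp_add_const f (2 * w) z, funext h,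
      ((hlin.cexp.const_mul k).fun_mul (hd z).hasDerivAt).deriv]
    ring
  rw [hder, h, mul_div_mul_left _ _ (mul_ne_zero hk (exp_ne_zero _)), add_div,
    mul_div_cancel_right₀ _ hz]

end QuasiPeriodic

section Coefficients

variable {ι : Type*} [Fintype ι] {f : ι → ℂ → ℂ} {w e : ℂ}

theorem prod_div_add_period (hf : ∀ p, QuasiPeriodic (f p) w e) (γ : ℂ) (μ μ' : ι → ℂ) (z : ℂ) :
    ∏ p, f p (z + 2 * w - μ p) * f p (z + 2 * w + γ - μ' p) /
        (f p (z + 2 * w) * f p (z + 2 * w + γ)) =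
      exp (-(2 * e * ∑ p, (μ p + μ' p))) *
        ∏ p, f p (z - μ p) * f p (z + γ - μ' p) / (f p z * f p (z + γ)) := by
  rw [Finset.mul_sum, ← Finset.sum_neg_distrib, exp_sum, ← Finset.prod_mul_distrib]
  refine Finset.prod_congr rfl fun p _ => ?_
  rw [mul_div_mul_comm, mul_div_mul_comm, (hf p).div_translate, add_right_comm z (2 * w) γ,
    (hf p).div_translate, mul_add, neg_add, exp_add]
  ring

theorem sum_deriv_div_sub_add_period (hf : ∀ p, QuasiPeriodic (f p) w e)
    (hd : ∀ p, Differentiable ℂ (f p)) (γ : ℂ) (κ : ι → ℂ) {z : ℂ}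
    (hz : ∀ p, f p (z + γ) ≠ 0 ∧ f p (z - γ) ≠ 0) :
    ∑ p, κ p * (deriv (f p) (z + 2 * w + γ) / f p (z + 2 * w + γ) -
        deriv (f p) (z + 2 * w - γ) / f p (z + 2 * w - γ)) =
      ∑ p, κ p * (deriv (f p) (z + γ) / f p (z + γ) - deriv (f p) (z - γ) / f p (z - γ)) := by
  refine Finset.sum_congr rfl fun p _ => ?_
  rw [add_right_comm z (2 * w) γ, add_sub_right_comm z (2 * w) γ,
    (hf p).deriv_div (hd p) (hz p).1, (hf p).deriv_div (hd p) (hz p).2]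
  ring

end Coefficients

/-- A three-term difference operator whose coefficients have the quasi-periods of those of the
Ruijsenaars operator preserves quasi-periodicity of exponential type `2 * M * e`. -/
theorem three_term_add_period {a c ψ : ℂ → ℂ} {M w e γ α z : ℂ}
    (ha : ∀ z, a (z + 2 * w) = exp (-(2 * e * (2 * γ * M))) * a z)
    (hc : c (z + 2 * w) = c z)
    (hψ : ∀ z, ψ (z + 2 * w) = exp (2 * M * e * z + α) * ψ z) :
    a (z + 2 * w) * ψ (z + 2 * w + 2 * γ) + a (-(z + 2 * w)) * ψ (z + 2 * w - 2 * γ)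
        + c (z + 2 * w) * ψ (z + 2 * w) =
      exp (2 * M * e * z + α) * (a z * ψ (z + 2 * γ) + a (-z) * ψ (z - 2 * γ) + c z * ψ z) := by
  have hneg : a (-z) = exp (-(2 * e * (2 * γ * M))) * a (-(z + 2 * w)) := by
    rw [← ha, neg_add, neg_add_cancel_right]
  have hplus : exp (2 * M * e * (z + 2 * γ) + α) * exp (-(2 * e * (2 * γ * M))) =
      exp (2 * M * e * z + α) := by
    rw [← exp_add]
    ring_nf
  have hminus : exp (2 * M * e * (z - 2 * γ) + α) =
      exp (2 * M * e * z + α) * exp (-(2 * e * (2 * γ * M))) := by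
    rw [← exp_add]
    ring_nf
  rw [add_right_comm z (2 * w) (2 * γ), add_sub_right_comm z (2 * w) (2 * γ), hψ, hψ, hψ, ha, hc,
    hneg, hminus, ← hplus]
  ring

/-- **Quasi-periodicity invariance.** For integer coupling parameters the `BC₁`
Ruijsenaars operator preserves the spaces `F^{α₁,α₂}_m` of functions with
`ψ(z + 2ω_s) = exp(2mη_s z + α_s) ψ(z)` (`s = 1, 2`): if an entire `ψ` lies in
`F^{α₁,α₂}_m`, then `Lψ` satisfies the same quasi-periodicity identities at all
points where the operator is defined. -/
theorem ruijsenaars_BC1_preserves_theta_spaces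
    -- the period lattice
    (ω1 ω2 : ℂ) (hind : LinearIndependent ℝ ![ω1, ω2])
    (η1 η2 : ℂ) (hleg : η1 * ω2 - η2 * ω1 = (Real.pi : ℂ) * Complex.I / 2)
    (ω : Fin 4 → ℂ) (hω : ω = ![0, ω1, ω2, -ω1 - ω2])
    (η : Fin 4 → ℂ) (hη : η = ![0, η1, η2, -η1 - η2])
    -- the Weierstrass sigma function
    (σ : ℂ → ℂ) (hσdiff : Differentiable ℂ σ)
    (hσodd : ∀ z, σ (-z) = -σ z)
    (hσzero : ∀ z, σ z = 0 ↔ ∃ n1 n2 : ℤ, z = 2 * ((n1 : ℂ) * ω1 + (n2 : ℂ) * ω2))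
    (hσsimple : ∀ z, σ z = 0 → deriv σ z ≠ 0)
    (hσnorm : deriv σ 0 = 1)
    (hσper : ∀ s : Fin 4, s = 1 ∨ s = 2 → ∀ z,
      σ (z + 2 * ω s) = -σ z * Complex.exp (2 * η s * (z + ω s)))
    -- the shifted sigma functions σ_r
    (σS : Fin 4 → ℂ → ℂ) (hσS0 : σS 0 = σ)
    (hσSr : ∀ r : Fin 4, r ≠ 0 → ∀ z,
      σS r z = Complex.exp (-η r * z) * σ (z + ω r) / σ (ω r))
    -- the permutations π₀ = id, π₁ = (01)(23), π₂ = (02)(13), π₃ = (03)(12)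
    (prm : Fin 4 → Fin 4 → Fin 4)
    (hprm : prm = ![![0, 1, 2, 3], ![1, 0, 3, 2], ![2, 3, 0, 1], ![3, 2, 1, 0]])
    -- the step γ and the integer coupling parameters
    (γ : ℂ) (hγ : ¬∃ q1 q2 : ℚ, γ = (q1 : ℂ) * ω1 + (q2 : ℂ) * ω2)
    (mi mi' : Fin 4 → ℕ)
    (μ μ' : Fin 4 → ℂ)
    (hμ : ∀ p, μ p = 2 * γ * (mi p : ℂ)) (hμ' : ∀ p, μ' p = 2 * γ * (mi' p : ℂ))
    (m : ℕ) (hm : m = ∑ p : Fin 4, (mi p + mi' p))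
    -- the coefficients of the Ruijsenaars operator L
    (a : ℂ → ℂ) (ha : ∀ z, a z =
      ∏ p : Fin 4, σS p (z - μ p) * σS p (z + γ - μ' p) / (σS p z * σS p (z + γ)))
    (cp : Fin 4 → ℂ) (hcp : ∀ p, cp p =
      -(2 / σ (2 * γ)) * ∏ s : Fin 4, σS s (γ + μ (prm p s)) * σS s (μ' (prm p s)))
    (c : ℂ → ℂ) (hc : ∀ z, c z = ∑ p : Fin 4, cp p *
      (deriv (σS p) (z + γ) / σS p (z + γ) - deriv (σS p) (z - γ) / σS p (z - γ)))
    -- an entire member ψ of F^{α₁,α₂}_m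
    (α1 α2 : ℂ) (ψ : ℂ → ℂ) (hψdiff : Differentiable ℂ ψ)
    (hψ1 : ∀ z, ψ (z + 2 * ω1) = Complex.exp (2 * (m : ℂ) * η1 * z + α1) * ψ z)
    (hψ2 : ∀ z, ψ (z + 2 * ω2) = Complex.exp (2 * (m : ℂ) * η2 * z + α2) * ψ z) :
    -- conclusion : Lψ has the same quasi-periodicity
    (∀ z : ℂ,
      (∀ p : Fin 4, σS p z ≠ 0 ∧ σS p (z + γ) ≠ 0 ∧ σS p (z - γ) ≠ 0) →
      (∀ p : Fin 4, σS p (z + 2 * ω1) ≠ 0 ∧ σS p (z + 2 * ω1 + γ) ≠ 0 ∧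
        σS p (z + 2 * ω1 - γ) ≠ 0) →
      a (z + 2 * ω1) * ψ (z + 2 * ω1 + 2 * γ) + a (-(z + 2 * ω1)) * ψ (z + 2 * ω1 - 2 * γ)
          + c (z + 2 * ω1) * ψ (z + 2 * ω1) =
        Complex.exp (2 * (m : ℂ) * η1 * z + α1) *
          (a z * ψ (z + 2 * γ) + a (-z) * ψ (z - 2 * γ) + c z * ψ z)) ∧
    (∀ z : ℂ,
      (∀ p : Fin 4, σS p z ≠ 0 ∧ σS p (z + γ) ≠ 0 ∧ σS p (z - γ) ≠ 0) →
      (∀ p : Fin 4, σS p (z + 2 * ω2) ≠ 0 ∧ σS p (z + 2 * ω2 + γ) ≠ 0 ∧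
        σS p (z + 2 * ω2 - γ) ≠ 0) →
      a (z + 2 * ω2) * ψ (z + 2 * ω2 + 2 * γ) + a (-(z + 2 * ω2)) * ψ (z + 2 * ω2 - 2 * γ)
          + c (z + 2 * ω2) * ψ (z + 2 * ω2) =
        Complex.exp (2 * (m : ℂ) * η2 * z + α2) *
          (a z * ψ (z + 2 * γ) + a (-z) * ψ (z - 2 * γ) + c z * ψ z)) := by
  have hdiff : ∀ p, Differentiable ℂ (σS p) := fun p => by
    by_cases hp : p = 0
    · rwa [hp, hσS0]
    · rw [funext (hσSr p hp)]
      fun_prop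
  have hquasi : ∀ s : Fin 4, s = 1 ∨ s = 2 → ∀ p, QuasiPeriodic (σS p) (ω s) (η s) :=
      fun s hs p => by
    have hσs : QuasiPeriodic σ (ω s) (η s) :=
      ⟨-1, by norm_num, fun z => by rw [hσper s hs]; ring⟩
    by_cases hp : p = 0
    · rwa [hp, hσS0]
    · rw [funext (hσSr p hp)]
      exact hσs.translate _ _ _
  have hsum : ∑ p, (μ p + μ' p) = 2 * γ * (m : ℂ) := by
    simp only [hm, hμ, hμ', ← mul_add, ← Finset.mul_sum]
    push_cast
    rfl
  have ha_period : ∀ s : Fin 4, s = 1 ∨ s = 2 → ∀ z,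
      a (z + 2 * ω s) = Complex.exp (-(2 * η s * (2 * γ * m))) * a z := fun s hs z => by
    rw [ha, ha, prod_div_add_period (hquasi s hs), hsum]
  have hc_period : ∀ s : Fin 4, s = 1 ∨ s = 2 → ∀ z,
      (∀ p, σS p z ≠ 0 ∧ σS p (z + γ) ≠ 0 ∧ σS p (z - γ) ≠ 0) →
      c (z + 2 * ω s) = c z := fun s hs z hz => by
    rw [hc, hc, sum_deriv_div_sub_add_period (hquasi s hs) hdiff γ cp fun p => (hz p).2]
  have hω1 : ω 1 = ω1 := by simp [hω]
  have hω2 : ω 2 = ω2 := by simp [hω]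
  have hη1 : η 1 = η1 := by simp [hη]
  have hη2 : η 2 = η2 := by simp [hη]
  have ha1 := ha_period 1 (.inl rfl)
  have ha2 := ha_period 2 (.inr rfl)
  have hc1 := hc_period 1 (.inl rfl)
  have hc2 := hc_period 2 (.inr rfl)
  rw [hω1, hη1] at ha1
  rw [hω2, hη2] at ha2
  rw [hω1] at hc1
  rw [hω2] at hc2
  exact ⟨fun z hz _ => three_term_add_period ha1 (hc1 z hz) hψ1,
    fun z hz _ => three_term_add_period ha2 (hc2 z hz) hψ2⟩
end

section
/- For each r = 0, …, 3 and every z ∈ ℂ at which both sides are defined (i.e. σ_p(z + γ) ≠ 0, σ_p(z − γ) ≠ 0, σ_p(z + ω_r + γ) ≠ 0 and σ_p(z + ω_r − γ) ≠ 0 for all p), one has c_μ(z + ω_r) = c_{μ̃}(z), where μ̃ is defined by μ̃_p = μ_{π_r(p)} and μ̃′_p = μ′_{π_r(p)}. -/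
open Filter Topology

/-- `f` and `g` differ by a factor `C * exp (a * z)` with `C ≠ 0`. -/
def ExpProportional (f g : ℂ → ℂ) : Prop :=
  ∃ a C : ℂ, C ≠ 0 ∧ ∀ z, f z = C * Complex.exp (a * z) * g z

namespace ExpProportional

variable {f g h : ℂ → ℂ}

theorem refl (f : ℂ → ℂ) : ExpProportional f f :=
  ⟨0, 1, one_ne_zero, fun z => by simp⟩

theorem symm (hfg : ExpProportional f g) : ExpProportional g f := by
  obtain ⟨a, C, hC, hf⟩ := hfg
  refine ⟨-a, C⁻¹, inv_ne_zero hC, fun z => ?_⟩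
  have := Complex.exp_ne_zero (a * z)
  rw [hf, neg_mul, Complex.exp_neg]
  field_simp

theorem trans (hfg : ExpProportional f g) (hgh : ExpProportional g h) :
    ExpProportional f h := by
  obtain ⟨a, C, hC, hf⟩ := hfg
  obtain ⟨b, D, hD, hg⟩ := hgh
  refine ⟨a + b, C * D, mul_ne_zero hC hD, fun z => ?_⟩
  rw [hf, hg, add_mul, Complex.exp_add]
  ring

theorem comp_add_const (hfg : ExpProportional f g) (w : ℂ) :
    ExpProportional (fun z => f (z + w)) (fun z => g (z + w)) := by
  obtain ⟨a, C, hC, hf⟩ := hfg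
  refine ⟨a, C * Complex.exp (a * w), mul_ne_zero hC (Complex.exp_ne_zero _), fun z => ?_⟩
  simp only [hf, mul_add, Complex.exp_add]
  ring

theorem logDeriv_sub_logDeriv (hfg : ExpProportional f g) (hg : Differentiable ℂ g)
    {x y : ℂ} (hx : g x ≠ 0) (hy : g y ≠ 0) :
    logDeriv f x - logDeriv f y = logDeriv g x - logDeriv g y := by
  obtain ⟨a, C, hC, hf⟩ := hfg
  have key : ∀ z, g z ≠ 0 → logDeriv f z = a + logDeriv g z := by
    intro z hz
    have hexp : HasDerivAt (fun z : ℂ => C * Complex.exp (a * z))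
        (C * (Complex.exp (a * z) * (a * 1))) z :=
      (((hasDerivAt_id z).const_mul a).cexp).const_mul C
    have hd := hexp.mul (hg z).hasDerivAt
    have hfun : f = (fun z => C * Complex.exp (a * z)) * g := funext hf
    have := Complex.exp_ne_zero (a * z)
    rw [logDeriv_apply, logDeriv_apply, hfun, hd.deriv, Pi.mul_apply]
    field_simp
  rw [key x hx, key y hy]
  ring

end ExpProportional

/-- The translations under which `f` is multiplied by a factor `C * exp (a * z)`. -/
def quasiPeriods (f : ℂ → ℂ) : AddSubgroup ℂ where
  carrier := {w | ExpProportional (fun z => f (z + w)) f}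
  zero_mem' := by simpa using ExpProportional.refl f
  add_mem' {v w} hv hw := by
    simpa [add_assoc, add_comm v w] using (hv.comp_add_const w).trans hw
  neg_mem' {w} hw := by
    simpa using (hw.comp_add_const (-w)).symm

/-- **Covariance of the coefficient `c` under half-period shifts (Chalykh, eq. (2.11)).**
For each `r = 0, …, 3` and every `z` at which both sides are defined,
`c_μ(z + ω_r) = c_{μ̃}(z)` with `μ̃_p = μ_{π_r(p)}`, `μ̃'_p = μ'_{π_r(p)}`. -/
theorem ruijsenaars_BC1_c_halfperiod_covariance
    -- the period lattice
    (ω1 ω2 : ℂ) (hind : LinearIndependent ℝ ![ω1, ω2])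
    (η1 η2 : ℂ) (hleg : η1 * ω2 - η2 * ω1 = (Real.pi : ℂ) * Complex.I / 2)
    (ω : Fin 4 → ℂ) (hω : ω = ![0, ω1, ω2, -ω1 - ω2])
    (η : Fin 4 → ℂ) (hη : η = ![0, η1, η2, -η1 - η2])
    -- the Weierstrass sigma function
    (σ : ℂ → ℂ) (hσdiff : Differentiable ℂ σ)
    (hσodd : ∀ z, σ (-z) = -σ z)
    (hσzero : ∀ z, σ z = 0 ↔ ∃ n1 n2 : ℤ, z = 2 * ((n1 : ℂ) * ω1 + (n2 : ℂ) * ω2))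
    (hσsimple : ∀ z, σ z = 0 → deriv σ z ≠ 0)
    (hσnorm : deriv σ 0 = 1)
    (hσper : ∀ s : Fin 4, s = 1 ∨ s = 2 → ∀ z,
      σ (z + 2 * ω s) = -σ z * Complex.exp (2 * η s * (z + ω s)))
    -- the shifted sigma functions σ_r
    (σS : Fin 4 → ℂ → ℂ) (hσS0 : σS 0 = σ)
    (hσSr : ∀ r : Fin 4, r ≠ 0 → ∀ z,
      σS r z = Complex.exp (-η r * z) * σ (z + ω r) / σ (ω r))
    -- the permutations π₀ = id, π₁ = (01)(23), π₂ = (02)(13), π₃ = (03)(12)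
    (prm : Fin 4 → Fin 4 → Fin 4)
    (hprm : prm = ![![0, 1, 2, 3], ![1, 0, 3, 2], ![2, 3, 0, 1], ![3, 2, 1, 0]])
    -- the step γ, arbitrary coupling parameters, and the coefficient c_μ
    (γ : ℂ) (hσ2γ : σ (2 * γ) ≠ 0) (μ μ' : Fin 4 → ℂ)
    (c : (Fin 4 → ℂ) → (Fin 4 → ℂ) → ℂ → ℂ)
    (hc : ∀ ν ν' : Fin 4 → ℂ, ∀ z, c ν ν' z =
      ∑ p : Fin 4,
        (-(2 / σ (2 * γ)) * ∏ s : Fin 4, σS s (γ + ν (prm p s)) * σS s (ν' (prm p s))) *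
          (deriv (σS p) (z + γ) / σS p (z + γ) - deriv (σS p) (z - γ) / σS p (z - γ))) :
    ∀ r : Fin 4, ∀ z : ℂ,
      (∀ p : Fin 4, σS p (z + γ) ≠ 0 ∧ σS p (z - γ) ≠ 0 ∧
        σS p (z + ω r + γ) ≠ 0 ∧ σS p (z + ω r - γ) ≠ 0) →
      c μ μ' (z + ω r) = c (fun p => μ (prm r p)) (fun p => μ' (prm r p)) z := by
  have hperiod : ∀ t, t = 1 ∨ t = 2 → 2 * ω t ∈ quasiPeriods σ := by
    refine fun t ht => ⟨2 * η t, -Complex.exp (2 * η t * ω t),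
      neg_ne_zero.2 (Complex.exp_ne_zero _), fun z => ?_⟩
    simp only [hσper t ht, mul_add, Complex.exp_add]
    ring
  have hmem1 : 2 * ω1 ∈ quasiPeriods σ := by simpa [hω] using hperiod 1 (Or.inl rfl)
  have hmem2 : 2 * ω2 ∈ quasiPeriods σ := by simpa [hω] using hperiod 2 (Or.inr rfl)
  have hlattice : ∀ w, (∃ m n : ℤ, (m : ℂ) * (2 * ω1) + n * (2 * ω2) = w) →
      w ∈ quasiPeriods σ := by
    rintro _ ⟨m, n, rfl⟩
    simpa using add_mem (zsmul_mem hmem1 m) (zsmul_mem hmem2 n)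
  have hshift : ∀ r p, ω r + ω p - ω (prm r p) ∈ quasiPeriods σ := by
    intro r p
    apply hlattice
    subst hω hprm
    fin_cases r <;> fin_cases p <;> simp only [Fin.reduceFinMk, Fin.zero_eta, Fin.mk_one,
      Matrix.cons_val]
    · exact ⟨0, 0, by simp⟩
    · exact ⟨0, 0, by simp⟩
    · exact ⟨0, 0, by simp⟩
    · exact ⟨0, 0, by simp⟩
    · exact ⟨0, 0, by simp⟩
    · exact ⟨1, 0, by push_cast; ring⟩
    · exact ⟨1, 1, by push_cast; ring⟩
    · exact ⟨0, -1, by push_cast; ring⟩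
    · exact ⟨0, 0, by simp⟩
    · exact ⟨1, 1, by push_cast; ring⟩
    · exact ⟨0, 1, by push_cast; ring⟩
    · exact ⟨-1, 0, by push_cast; ring⟩
    · exact ⟨0, 0, by simp⟩
    · exact ⟨0, -1, by push_cast; ring⟩
    · exact ⟨-1, 0, by push_cast; ring⟩
    · exact ⟨-1, -1, by push_cast; ring⟩
  have hinv : ∀ r, Function.Involutive (prm r) := by
    subst hprm
    unfold Function.Involutive
    decide
  have hcomp : ∀ r p s, prm r (prm (prm r p) s) = prm p s := by
    subst hprm
    decide
  intro r z hz
  have hσS : ∀ p, ExpProportional (σS p) (fun z => σ (z + ω p)) := by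
    intro p
    by_cases hp : p = 0
    · subst hp
      simpa [hσS0, hω] using ExpProportional.refl σ
    · have hωp : σ (ω p) ≠ 0 := by
        intro h
        apply (hz p).1
        rw [hσSr p hp, h, div_zero]
      refine ⟨-η p, (σ (ω p))⁻¹, inv_ne_zero hωp, fun z => ?_⟩
      rw [hσSr p hp]
      ring
  have hdiff : ∀ p, Differentiable ℂ (σS p) := by
    intro p
    obtain ⟨a, C, -, h⟩ := hσS p
    rw [funext h]
    fun_prop
  have hprop : ∀ p, ExpProportional (fun z => σS p (z + ω r)) (σS (prm r p)) := by
    intro p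
    have h : ExpProportional (fun z => σ (z + (ω r + ω p - ω (prm r p)))) σ := hshift r p
    refine ((hσS p).comp_add_const (ω r)).trans (.trans ?_ (hσS (prm r p)).symm)
    convert h.comp_add_const (ω (prm r p)) using 3
    ring
  have hzeta : ∀ p, deriv (σS p) (z + ω r + γ) / σS p (z + ω r + γ) -
      deriv (σS p) (z + ω r - γ) / σS p (z + ω r - γ) =
      deriv (σS (prm r p)) (z + γ) / σS (prm r p) (z + γ) -
      deriv (σS (prm r p)) (z - γ) / σS (prm r p) (z - γ) := by
    intro p
    have h := (hprop p).logDeriv_sub_logDeriv (hdiff _) (hz (prm r p)).1 (hz (prm r p)).2.1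
    simpa only [logDeriv_apply, deriv_comp_add_const, add_right_comm z γ,
      sub_add_eq_add_sub z γ] using h
  rw [hc, hc]
  refine Fintype.sum_equiv (hinv r).toPerm _ _ fun p => ?_
  simp only [Function.Involutive.coe_toPerm, hcomp, hzeta]
end

section
/- The coefficient c_μ is an even function: c_μ(−z) = c_μ(z) for every z ∈ ℂ with σ_p(z + γ) ≠ 0 and σ_p(z − γ) ≠ 0 for all p = 0, …, 3. -/
open Filter Topology

/-- The logarithmic derivative of an even or odd function is odd. -/
theorem deriv_div_self_neg {f : ℂ → ℂ} {ε : ℂ} (hε : ε ≠ 0) (hf : ∀ z, f (-z) = ε * f z)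
    (z : ℂ) : deriv f (-z) / f (-z) = -(deriv f z / f z) := by
  have h : -deriv f (-z) = ε * deriv f z := by
    rw [← deriv_comp_neg, funext hf, deriv_const_mul_field]
  rw [hf, ← neg_neg (deriv f (-z)), h, neg_div, mul_div_mul_left _ _ hε]

/-- The half-period shift of an odd quasi-periodic function, corrected by the exponential factor,
is even. -/
theorem exp_mul_shift_even {σ : ℂ → ℂ} (hodd : ∀ z, σ (-z) = -σ z) {w e : ℂ}
    (hper : ∀ z, σ (z + 2 * w) = -σ z * Complex.exp (2 * e * (z + w))) (z : ℂ) :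
    Complex.exp (-e * -z) * σ (-z + w) / σ w = Complex.exp (-e * z) * σ (z + w) / σ w := by
  have h := hper (z - w)
  rw [show z - w + 2 * w = z + w by ring, sub_add_cancel] at h
  have hexp : Complex.exp (-e * z) * Complex.exp (2 * e * z) = Complex.exp (-e * -z) := by
    rw [← Complex.exp_add]
    ring_nf
  rw [h, show -z + w = -(z - w) by ring, hodd, ← hexp]
  ring

/-- Quasi-periodicity with respect to the third period `2 * (-w₁ - w₂)`, from the Legendre
relation. -/
theorem quasiperiodic_neg_sub {σ : ℂ → ℂ} {w₁ w₂ e₁ e₂ : ℂ}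
    (hleg : e₁ * w₂ - e₂ * w₁ = (Real.pi : ℂ) * Complex.I / 2)
    (h₁ : ∀ z, σ (z + 2 * w₁) = -σ z * Complex.exp (2 * e₁ * (z + w₁)))
    (h₂ : ∀ z, σ (z + 2 * w₂) = -σ z * Complex.exp (2 * e₂ * (z + w₂))) (z : ℂ) :
    σ (z + 2 * (-w₁ - w₂)) =
      -σ z * Complex.exp (2 * (-e₁ - e₂) * (z + (-w₁ - w₂))) := by
  set y := z + 2 * (-w₁ - w₂) with hy
  have hz : σ z = σ y * (Complex.exp (2 * e₂ * (y + w₂)) *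
      Complex.exp (2 * e₁ * (y + 2 * w₂ + w₁))) := by
    rw [show z = y + 2 * w₂ + 2 * w₁ by rw [hy]; ring, h₁, h₂]
    ring
  have hexp : Complex.exp (2 * e₂ * (y + w₂)) * Complex.exp (2 * e₁ * (y + 2 * w₂ + w₁)) *
      Complex.exp (2 * (-e₁ - e₂) * (z + (-w₁ - w₂))) = -1 := by
    rw [← Complex.exp_add, ← Complex.exp_add, ← Complex.exp_pi_mul_I]
    congr 1
    rw [hy]
    linear_combination 2 * hleg
  rw [hz]
  linear_combination σ y * hexp

/-- **Evenness of the coefficient `c` (Chalykh).** The coefficient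
`c_μ(z) = Σ_p c_p (ζ_p(z + γ) - ζ_p(z - γ))` of the `BC₁` Ruijsenaars operator is an even
function: `c_μ(-z) = c_μ(z)` wherever it is defined. -/
theorem ruijsenaars_BC1_c_even
    -- the period lattice
    (ω1 ω2 : ℂ) (hind : LinearIndependent ℝ ![ω1, ω2])
    (η1 η2 : ℂ) (hleg : η1 * ω2 - η2 * ω1 = (Real.pi : ℂ) * Complex.I / 2)
    (ω : Fin 4 → ℂ) (hω : ω = ![0, ω1, ω2, -ω1 - ω2])
    (η : Fin 4 → ℂ) (hη : η = ![0, η1, η2, -η1 - η2])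
    -- the Weierstrass sigma function
    (σ : ℂ → ℂ) (hσdiff : Differentiable ℂ σ)
    (hσodd : ∀ z, σ (-z) = -σ z)
    (hσzero : ∀ z, σ z = 0 ↔ ∃ n1 n2 : ℤ, z = 2 * ((n1 : ℂ) * ω1 + (n2 : ℂ) * ω2))
    (hσsimple : ∀ z, σ z = 0 → deriv σ z ≠ 0)
    (hσnorm : deriv σ 0 = 1)
    (hσper : ∀ s : Fin 4, s = 1 ∨ s = 2 → ∀ z,
      σ (z + 2 * ω s) = -σ z * Complex.exp (2 * η s * (z + ω s)))
    -- the shifted sigma functions σ_r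
    (σS : Fin 4 → ℂ → ℂ) (hσS0 : σS 0 = σ)
    (hσSr : ∀ r : Fin 4, r ≠ 0 → ∀ z,
      σS r z = Complex.exp (-η r * z) * σ (z + ω r) / σ (ω r))
    -- the permutations π₀ = id, π₁ = (01)(23), π₂ = (02)(13), π₃ = (03)(12)
    (prm : Fin 4 → Fin 4 → Fin 4)
    (hprm : prm = ![![0, 1, 2, 3], ![1, 0, 3, 2], ![2, 3, 0, 1], ![3, 2, 1, 0]])
    -- the step γ, arbitrary coupling parameters, and the coefficient c_μ
    (γ : ℂ) (hσ2γ : σ (2 * γ) ≠ 0) (μ μ' : Fin 4 → ℂ)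
    (cp : Fin 4 → ℂ) (hcp : ∀ p, cp p =
      -(2 / σ (2 * γ)) * ∏ s : Fin 4, σS s (γ + μ (prm p s)) * σS s (μ' (prm p s)))
    (c : ℂ → ℂ) (hc : ∀ z, c z = ∑ p : Fin 4, cp p *
      (deriv (σS p) (z + γ) / σS p (z + γ) - deriv (σS p) (z - γ) / σS p (z - γ))) :
    ∀ z : ℂ, (∀ p : Fin 4, σS p (z + γ) ≠ 0 ∧ σS p (z - γ) ≠ 0) → c (-z) = c z := by
  have h₁ := hσper 1 (Or.inl rfl)
  have h₂ := hσper 2 (Or.inr rfl)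
  have h₃ : ∀ z, σ (z + 2 * ω 3) = -σ z * Complex.exp (2 * η 3 * (z + ω 3)) := by
    subst hω hη
    exact quasiperiodic_neg_sub hleg h₁ h₂
  have hper : ∀ r : Fin 4, r ≠ 0 → ∀ z,
      σ (z + 2 * ω r) = -σ z * Complex.exp (2 * η r * (z + ω r)) := by
    intro r hr
    fin_cases r
    exacts [absurd rfl hr, h₁, h₂, h₃]
  have hodd : ∀ p z, deriv (σS p) (-z) / σS p (-z) = -(deriv (σS p) z / σS p z) := by
    intro p
    by_cases hp : p = 0
    · rw [hp, hσS0]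
      exact deriv_div_self_neg (ε := -1) (by norm_num) (by simpa using hσodd)
    · refine deriv_div_self_neg one_ne_zero fun z => ?_
      rw [one_mul, hσSr p hp, hσSr p hp]
      exact exp_mul_shift_even hσodd (hper p hp) z
  intro z _
  rw [hc, hc]
  refine Finset.sum_congr rfl fun p _ => ?_
  rw [show -z + γ = -(z - γ) by ring, show -z - γ = -(z + γ) by ring, hodd, hodd]
  ring
end
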